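/- Let f₁ : R₁ → R₀ and f₂ : R₂ → R₀ be homomorphisms of commutative rings with f₂ surjective, and let R = R₁ ×_{R₀} R₂ be the fiber product ring. Then the functor sending a finite projective R-module P to the triple (P ⊗_R R₁, P ⊗_R R₂, α_P), where α_P is the canonical isomorphism (P ⊗_R R₁) ⊗_{R₁} R₀ ≅ (P ⊗_R R₂) ⊗_{R₂} R₀, is an equivalence from the category of finite projective R-modules to the category of triples (P₁, P₂, α) consisting of a finite projective R₁-module P₁, a finite projective R₂-module P₂, and an R₀-module isomorphism α : P₁ ⊗_{R₁} R₀ ≅ P₂ ⊗_{R₂} R₀. -/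

import Mathlib

open TensorProduct

section

variable (R₀ R₁ R₂ : Type) [CommRing R₀] [CommRing R₁] [CommRing R₂]
variable [Algebra R₁ R₀] [Algebra R₂ R₀]

/-- The fiber product ring `R = R₁ ×_{R₀} R₂` of `f₁ = algebraMap R₁ R₀` and
`f₂ = algebraMap R₂ R₀`, as a subring of `R₁ × R₂`. -/
def fiberRing : Subring (R₁ × R₂) where
  carrier := {p | algebraMap R₁ R₀ p.1 = algebraMap R₂ R₀ p.2}
  mul_mem' := fun {a b} ha hb => by
    simp only [Set.mem_setOf_eq, Prod.fst_mul, Prod.snd_mul, map_mul] at *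
    rw [ha, hb]
  add_mem' := fun {a b} ha hb => by
    simp only [Set.mem_setOf_eq, Prod.fst_add, Prod.snd_add, map_add] at *
    rw [ha, hb]
  one_mem' := by simp
  zero_mem' := by simp
  neg_mem' := fun {a} ha => by
    simp only [Set.mem_setOf_eq, Prod.fst_neg, Prod.snd_neg, map_neg] at *
    rw [ha]

local instance : Algebra (fiberRing R₀ R₁ R₂) R₁ :=
  ((RingHom.fst R₁ R₂).comp (fiberRing R₀ R₁ R₂).subtype).toAlgebra

local instance : Algebra (fiberRing R₀ R₁ R₂) R₂ :=
  ((RingHom.snd R₁ R₂).comp (fiberRing R₀ R₁ R₂).subtype).toAlgebra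

local instance : Algebra (fiberRing R₀ R₁ R₂) R₀ :=
  ((algebraMap R₁ R₀).comp
    ((RingHom.fst R₁ R₂).comp (fiberRing R₀ R₁ R₂).subtype)).toAlgebra

local instance : IsScalarTower (fiberRing R₀ R₁ R₂) R₁ R₀ :=
  IsScalarTower.of_algebraMap_eq fun _ => rfl

local instance : IsScalarTower (fiberRing R₀ R₁ R₂) R₂ R₀ :=
  IsScalarTower.of_algebraMap_eq fun x => x.property

/-- The canonical glueing isomorphism
`(P ⊗_R R₁) ⊗_{R₁} R₀ ≅ P ⊗_R R₀ ≅ (P ⊗_R R₂) ⊗_{R₂} R₀` for an `R`-module `P`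
(written with the base rings on the left). -/
noncomputable def canGlue (P : ModuleCat (fiberRing R₀ R₁ R₂)) :
    R₀ ⊗[R₁] (R₁ ⊗[fiberRing R₀ R₁ R₂] P) ≃ₗ[R₀] R₀ ⊗[R₂] (R₂ ⊗[fiberRing R₀ R₁ R₂] P) :=
  (TensorProduct.AlgebraTensorModule.cancelBaseChange (fiberRing R₀ R₁ R₂) R₁ R₀ R₀ P).trans
    (TensorProduct.AlgebraTensorModule.cancelBaseChange (fiberRing R₀ R₁ R₂) R₂ R₀ R₀ P).symm

section Patching

variable {A B₀ B₁ B₂ : Type*} [CommRing A] [CommRing B₀] [CommRing B₁] [CommRing B₂]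
  [Algebra B₁ B₀] [Algebra B₂ B₀]

/-- If `A = B₁ ×_{B₀} B₂` and `Q` is a flat `A`-module, then `Q` is the fiber product of
`B₁ ⊗[A] Q` and `B₂ ⊗[A] Q` over `B₀ ⊗[A] Q`. -/
theorem existsUnique_one_tmul_of_flat [Algebra A B₀] [Algebra A B₁] [Algebra A B₂]
    [IsScalarTower A B₁ B₀] [IsScalarTower A B₂ B₀]
    (hinj : ∀ a : A, algebraMap A B₁ a = 0 → algebraMap A B₂ a = 0 → a = 0)
    (hex : ∀ b₁ b₂, algebraMap B₁ B₀ b₁ = algebraMap B₂ B₀ b₂ →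
      ∃ a : A, algebraMap A B₁ a = b₁ ∧ algebraMap A B₂ a = b₂)
    {Q : Type*} [AddCommGroup Q] [Module A Q] [Module.Flat A Q]
    (x : B₁ ⊗[A] Q) (y : B₂ ⊗[A] Q)
    (h : (IsScalarTower.toAlgHom A B₁ B₀).toLinearMap.rTensor Q x =
      (IsScalarTower.toAlgHom A B₂ B₀).toLinearMap.rTensor Q y) :
    ∃! q : Q, (1 : B₁) ⊗ₜ[A] q = x ∧ (1 : B₂) ⊗ₜ[A] q = y := by
  let f₁ : B₁ →ₗ[A] B₀ := (IsScalarTower.toAlgHom A B₁ B₀).toLinearMap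
  let f₂ : B₂ →ₗ[A] B₀ := (IsScalarTower.toAlgHom A B₂ B₀).toLinearMap
  let d : A →ₗ[A] B₁ × B₂ := (Algebra.linearMap A B₁).prod (Algebra.linearMap A B₂)
  let g : B₁ × B₂ →ₗ[A] B₀ := f₁ ∘ₗ LinearMap.fst A B₁ B₂ - f₂ ∘ₗ LinearMap.snd A B₁ B₂
  have hd : Function.Injective d := by
    refine (injective_iff_map_eq_zero d).2 fun a ha => ?_
    exact hinj a (congrArg Prod.fst ha) (congrArg Prod.snd ha)
  have hdg : Function.Exact d g := by
    rintro ⟨b₁, b₂⟩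
    constructor
    · intro hb
      obtain ⟨a, h₁, h₂⟩ := hex b₁ b₂ (sub_eq_zero.1 hb)
      exact ⟨a, Prod.ext h₁ h₂⟩
    · rintro ⟨a, ha⟩
      rw [← ha]
      refine sub_eq_zero.2 ?_
      exact (IsScalarTower.algebraMap_apply A B₁ B₀ a).symm.trans
        (IsScalarTower.algebraMap_apply A B₂ B₀ a)
  have hdQ : Function.Injective (d.rTensor Q) :=
    Module.Flat.rTensor_preserves_injective_linearMap d hd
  have hdgQ : Function.Exact (d.rTensor Q) (g.rTensor Q) := Module.Flat.rTensor_exact Q hdg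
  let e := TensorProduct.prodLeft A A B₁ B₂ Q
  have hdtmul (q : Q) : e (d.rTensor Q (1 ⊗ₜ q)) = (1 ⊗ₜ q, 1 ⊗ₜ q) := by
    simp [e, d]
  have hgr : g.rTensor Q = (f₁.rTensor Q ∘ₗ LinearMap.fst A _ _ -
      f₂.rTensor Q ∘ₗ LinearMap.snd A _ _) ∘ₗ e.toLinearMap := by
    ext b q
    · simp [e, g]
    · simp [e, g]
  have hz : g.rTensor Q (e.symm (x, y)) = 0 := by
    rw [hgr]
    simpa [sub_eq_zero] using h
  obtain ⟨w, hw⟩ := (hdgQ _).1 hz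
  obtain ⟨q, rfl⟩ := (TensorProduct.lid A Q).symm.surjective w
  rw [TensorProduct.lid_symm_apply] at hw
  have hq : ((1 : B₁) ⊗ₜ[A] q, (1 : B₂) ⊗ₜ[A] q) = (x, y) := by
    rw [← hdtmul, hw, e.apply_symm_apply]
  refine ⟨q, ⟨congrArg Prod.fst hq, congrArg Prod.snd hq⟩, ?_⟩
  rintro q' ⟨h₁, h₂⟩
  apply (TensorProduct.lid A Q).symm.injective
  apply hdQ
  apply e.injective
  rw [TensorProduct.lid_symm_apply, TensorProduct.lid_symm_apply, hdtmul, hdtmul, hq, h₁, h₂]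

variable {P₁ P₂ M : Type*} [AddCommGroup P₁] [AddCommGroup P₂] [AddCommGroup M]
  [Module B₁ P₁] [Module B₂ P₂] [Module A M]
  [Module A P₁] [Module A P₂]

/-- `M` is the fiber product of `P₁` and `P₂` along the glueing isomorphism `α`. -/
structure IsGluing (α : B₀ ⊗[B₁] P₁ ≃ₗ[B₀] B₀ ⊗[B₂] P₂) (q₁ : M →ₗ[A] P₁) (q₂ : M →ₗ[A] P₂) :
    Prop where
  compat : ∀ m, α (1 ⊗ₜ q₁ m) = 1 ⊗ₜ q₂ m
  eq_zero : ∀ m, q₁ m = 0 → q₂ m = 0 → m = 0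
  exists_lift : ∀ x y, α (1 ⊗ₜ x) = 1 ⊗ₜ y → ∃ m, q₁ m = x ∧ q₂ m = y

/-- The fiber product of `P₁` and `P₂` along the glueing isomorphism `α`. -/
def gluing [Algebra A B₀] [Algebra A B₁] [Algebra A B₂]
    [IsScalarTower A B₁ B₀] [IsScalarTower A B₂ B₀]
    [IsScalarTower A B₁ P₁] [IsScalarTower A B₂ P₂]
    (α : B₀ ⊗[B₁] P₁ ≃ₗ[B₀] B₀ ⊗[B₂] P₂) : Submodule A (P₁ × P₂) where
  carrier := {p | α (1 ⊗ₜ p.1) = 1 ⊗ₜ p.2}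
  add_mem' {p q} hp hq := by
    simp only [Set.mem_ofPred_eq, Prod.fst_add, Prod.snd_add, TensorProduct.tmul_add, map_add] at *
    rw [hp, hq]
  zero_mem' := by simp
  smul_mem' a p hp := by
    simp only [Set.mem_ofPred_eq, Prod.smul_fst, Prod.smul_snd] at *
    rw [← algebraMap_smul B₁ a p.1, ← algebraMap_smul B₂ a p.2, TensorProduct.tmul_smul,
      TensorProduct.tmul_smul, ← algebraMap_smul B₀, ← algebraMap_smul B₀ (algebraMap A B₂ a),
      map_smul, hp, ← IsScalarTower.algebraMap_apply, ← IsScalarTower.algebraMap_apply]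

theorem isGluing_gluing [Algebra A B₀] [Algebra A B₁] [Algebra A B₂]
    [IsScalarTower A B₁ B₀] [IsScalarTower A B₂ B₀]
    [IsScalarTower A B₁ P₁] [IsScalarTower A B₂ P₂]
    (α : B₀ ⊗[B₁] P₁ ≃ₗ[B₀] B₀ ⊗[B₂] P₂) :
    IsGluing α (LinearMap.fst A P₁ P₂ ∘ₗ (gluing (A := A) α).subtype)
      (LinearMap.snd A P₁ P₂ ∘ₗ (gluing (A := A) α).subtype) where
  compat m := m.2
  eq_zero _ h₁ h₂ := Subtype.ext (Prod.ext h₁ h₂)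
  exists_lift x y h := ⟨⟨(x, y), h⟩, rfl, rfl⟩

namespace IsGluing

variable {α : B₀ ⊗[B₁] P₁ ≃ₗ[B₀] B₀ ⊗[B₂] P₂} {q₁ : M →ₗ[A] P₁} {q₂ : M →ₗ[A] P₂}

theorem comp_equiv {N : Type*} [AddCommGroup N] [Module A N] (h : IsGluing α q₁ q₂)
    (e : N ≃ₗ[A] M) : IsGluing α (q₁ ∘ₗ e.toLinearMap) (q₂ ∘ₗ e.toLinearMap) where
  compat n := h.compat (e n)
  eq_zero n h₁ h₂ := by simpa using h.eq_zero (e n) h₁ h₂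
  exists_lift x y hxy := by
    obtain ⟨m, hm⟩ := h.exists_lift x y hxy
    exact ⟨e.symm m, by simpa using hm⟩

theorem ext (h : IsGluing α q₁ q₂) {m m' : M} (h₁ : q₁ m = q₁ m') (h₂ : q₂ m = q₂ m') :
    m = m' :=
  sub_eq_zero.1 (h.eq_zero _ (by simp [h₁]) (by simp [h₂]))

theorem exists_one_tmul (hf₂ : Function.Surjective (algebraMap B₂ B₀)) (z : B₀ ⊗[B₂] P₂) :
    ∃ y : P₂, z = 1 ⊗ₜ y := by
  obtain ⟨y, hy⟩ := TensorProduct.mk_surjective B₂ P₂ B₀ hf₂ z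
  exact ⟨y, hy.symm⟩

theorem surjective_left (h : IsGluing α q₁ q₂) (hf₂ : Function.Surjective (algebraMap B₂ B₀)) :
    Function.Surjective q₁ := fun x => by
  obtain ⟨y, hy⟩ := exists_one_tmul hf₂ (α (1 ⊗ₜ x))
  obtain ⟨m, hm, -⟩ := h.exists_lift x y hy
  exact ⟨m, hm⟩

theorem mem_range_of_one_tmul_eq_zero (h : IsGluing α q₁ q₂) {y : P₂}
    (hy : (1 : B₀) ⊗ₜ[B₂] y = 0) : y ∈ Set.range q₂ := by
  obtain ⟨m, -, hm⟩ := h.exists_lift 0 y (by simp [hy])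
  exact ⟨m, hm⟩

theorem span_range_right (h : IsGluing α q₁ q₂) (hf₂ : Function.Surjective (algebraMap B₂ B₀)) :
    Submodule.span B₂ (Set.range q₂) = ⊤ := by
  have key : ∀ w : B₀ ⊗[B₁] P₁, ∃ y ∈ Submodule.span B₂ (Set.range q₂), α w = 1 ⊗ₜ y := by
    intro w
    induction w with
    | zero => exact ⟨0, zero_mem _, by simp⟩
    | add v w hv hw =>
      obtain ⟨y, hy, hvy⟩ := hv
      obtain ⟨z, hz, hwz⟩ := hw
      exact ⟨y + z, add_mem hy hz, by rw [map_add, hvy, hwz, TensorProduct.tmul_add]⟩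
    | tmul r x =>
      obtain ⟨b, rfl⟩ := hf₂ r
      obtain ⟨m, rfl⟩ := h.surjective_left hf₂ x
      refine ⟨b • q₂ m, Submodule.smul_mem _ _ (Submodule.subset_span ⟨m, rfl⟩), ?_⟩
      have : algebraMap B₂ B₀ b ⊗ₜ[B₁] q₁ m = algebraMap B₂ B₀ b • ((1 : B₀) ⊗ₜ[B₁] q₁ m) := by
        rw [TensorProduct.smul_tmul', smul_eq_mul, mul_one]
      rw [this, map_smul, h.compat, algebraMap_smul, TensorProduct.tmul_smul]
  refine Submodule.eq_top_iff'.2 fun y => ?_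
  obtain ⟨y', hy', hyy'⟩ := key (α.symm (1 ⊗ₜ y))
  rw [α.apply_symm_apply] at hyy'
  have := h.mem_range_of_one_tmul_eq_zero (y := y - y')
    (by rw [TensorProduct.tmul_sub, hyy', sub_self])
  simpa using add_mem (Submodule.subset_span this) hy'

end IsGluing

/-- A finite module spanned by the range of a map is spanned by finitely many of its values. -/
theorem exists_fin_span_range_comp_eq_top {B P N : Type*} [Semiring B] [AddCommMonoid P]
    [Module B P] [Module.Finite B P] (q : N → P) (hq : Submodule.span B (Set.range q) = ⊤) :
    ∃ (n : ℕ) (m : Fin n → N), Submodule.span B (Set.range (q ∘ m)) = ⊤ := by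
  obtain ⟨t, ht, hspan⟩ := (Submodule.fg_span_iff_fg_span_finset_subset (Set.range q)).1
    (hq ▸ (Module.Finite.fg_top : (⊤ : Submodule B P).FG))
  choose m hm using fun i : Fin t.card => ht (t.equivFin.symm i).2
  refine ⟨t.card, m, ?_⟩
  rw [← hq, hspan]
  congr 1
  ext x
  constructor
  · rintro ⟨i, rfl⟩
    simp only [Function.comp_apply, hm]
    exact (t.equivFin.symm i).2
  · intro hx
    exact ⟨t.equivFin ⟨x, hx⟩, by simp [hm]⟩

namespace IsGluing

variable {α : B₀ ⊗[B₁] P₁ ≃ₗ[B₀] B₀ ⊗[B₂] P₂} {q₁ : M →ₗ[A] P₁} {q₂ : M →ₗ[A] P₂}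

theorem exists_generators [Module.Finite B₁ P₁] [Module.Finite B₂ P₂] (h : IsGluing α q₁ q₂)
    (hf₂ : Function.Surjective (algebraMap B₂ B₀)) :
    ∃ (ι : Type) (_ : Fintype ι) (m : ι → M),
      Submodule.span B₁ (Set.range (q₁ ∘ m)) = ⊤ ∧ Submodule.span B₂ (Set.range (q₂ ∘ m)) = ⊤ := by
  obtain ⟨n₁, m₁, h₁⟩ := exists_fin_span_range_comp_eq_top (B := B₁) q₁
    (by rw [(h.surjective_left hf₂).range_eq, Submodule.span_univ])
  obtain ⟨n₂, m₂, h₂⟩ := exists_fin_span_range_comp_eq_top (B := B₂) q₂ (h.span_range_right hf₂)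
  refine ⟨Fin n₁ ⊕ Fin n₂, inferInstance, Sum.elim m₁ m₂, ?_, ?_⟩
  · rw [eq_top_iff, ← h₁]
    refine Submodule.span_mono ?_
    rintro _ ⟨i, rfl⟩
    exact ⟨Sum.inl i, rfl⟩
  · rw [eq_top_iff, ← h₂]
    refine Submodule.span_mono ?_
    rintro _ ⟨i, rfl⟩
    exact ⟨Sum.inr i, rfl⟩

/-- Sections of the maps `B₁^ι → P₁` and `B₂^ι → P₂` given by a common family of generators can
be chosen to agree over `B₀`. -/
theorem exists_sections [Module.Projective B₁ P₁] [Module.Projective B₂ P₂]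
    (h : IsGluing α q₁ q₂) (hf₂ : Function.Surjective (algebraMap B₂ B₀))
    {ι : Type*} [Fintype ι] (m : ι → M)
    (h₁ : Submodule.span B₁ (Set.range (q₁ ∘ m)) = ⊤)
    (h₂ : Submodule.span B₂ (Set.range (q₂ ∘ m)) = ⊤) :
    ∃ (s₁ : P₁ →ₗ[B₁] ι → B₁) (s₂ : P₂ →ₗ[B₂] ι → B₂),
      (∀ x, Fintype.linearCombination B₁ (q₁ ∘ m) (s₁ x) = x) ∧
      (∀ y, Fintype.linearCombination B₂ (q₂ ∘ m) (s₂ y) = y) ∧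
      ∀ k i, algebraMap B₁ B₀ (s₁ (q₁ k) i) = algebraMap B₂ B₀ (s₂ (q₂ k) i) := by
  let π₁ := Fintype.linearCombination B₁ (q₁ ∘ m)
  let π₂ := Fintype.linearCombination B₂ (q₂ ∘ m)
  let f₁ : (ι → B₁) →ₗ[B₁] ι → B₀ := (Algebra.linearMap B₁ B₀).compLeft ι
  let f₂ : (ι → B₂) →ₗ[B₂] ι → B₀ := (Algebra.linearMap B₂ B₀).compLeft ι
  obtain ⟨s₁, hs₁⟩ := Module.projective_lifting_property π₁ LinearMap.id
    (by rw [← LinearMap.range_eq_top, Fintype.range_linearCombination, h₁])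
  obtain ⟨σ, hσ⟩ := Module.projective_lifting_property π₂ LinearMap.id
    (by rw [← LinearMap.range_eq_top, Fintype.range_linearCombination, h₂])
  replace hs₁ (x : P₁) : π₁ (s₁ x) = x := LinearMap.congr_fun hs₁ x
  replace hσ (y : P₂) : π₂ (σ y) = y := LinearMap.congr_fun hσ y
  let c : B₀ ⊗[B₁] P₁ →ₗ[B₀] ι → B₀ := (f₁ ∘ₗ s₁).liftBaseChange B₀
  let c' : P₂ →ₗ[B₂] ι → B₀ :=
    ((c ∘ₗ α.symm.toLinearMap).restrictScalars B₂) ∘ₗ TensorProduct.mk B₂ B₀ P₂ 1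
  obtain ⟨t, ht⟩ := Module.projective_lifting_property f₂ c' (hf₂.comp_left)
  have hc (k : M) : f₂ (t (q₂ k)) = f₁ (s₁ (q₁ k)) := by
    have : c' (q₂ k) = f₁ (s₁ (q₁ k)) := by
      simp [c', c, ← h.compat]
    rw [← this, ← ht, LinearMap.comp_apply]
  have hπ (v : ι → B₂) (w : ι → B₁) (hvw : f₂ v = f₁ w) :
      (1 : B₀) ⊗ₜ[B₂] π₂ v = α (1 ⊗ₜ π₁ w) := by
    simp only [π₁, π₂, Fintype.linearCombination_apply, TensorProduct.tmul_sum, map_sum]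
    refine Finset.sum_congr rfl fun i _ => ?_
    have hi : algebraMap B₂ B₀ (v i) = algebraMap B₁ B₀ (w i) := congrFun hvw i
    rw [TensorProduct.tmul_smul, TensorProduct.tmul_smul, ← algebraMap_smul B₀ (v i),
      ← algebraMap_smul B₀ (w i), map_smul, Function.comp_apply, Function.comp_apply, h.compat, hi]
  have hσ₀ (y : P₂) (hy : (1 : B₀) ⊗ₜ[B₂] y = 0) : f₂ (σ y) = 0 := by
    have := congrArg ((f₂ ∘ₗ σ).liftBaseChange B₀) hy
    simpa using this
  refine ⟨s₁, t + σ ∘ₗ (LinearMap.id - π₂ ∘ₗ t), hs₁, fun y => ?_, fun k i => ?_⟩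
  · change π₂ (t y + σ (y - π₂ (t y))) = y
    rw [map_add, hσ, add_sub_cancel]
  · have hk : (1 : B₀) ⊗ₜ[B₂] (q₂ k - π₂ (t (q₂ k))) = 0 := by
      rw [TensorProduct.tmul_sub, hπ _ _ (hc k), hs₁, h.compat, sub_self]
    have : f₂ (t (q₂ k) + σ (q₂ k - π₂ (t (q₂ k)))) = f₁ (s₁ (q₁ k)) := by
      rw [map_add, hσ₀ _ hk, add_zero, hc]
    exact (congrFun this i).symm

/-- The glueing of finite projective modules is a retract of a finite free module, compatibly
with the two projections. -/
theorem exists_retraction [Algebra A B₁] [Algebra A B₂]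
    [IsScalarTower A B₁ P₁] [IsScalarTower A B₂ P₂]
    [Module.Finite B₁ P₁] [Module.Finite B₂ P₂]
    [Module.Projective B₁ P₁] [Module.Projective B₂ P₂]
    (h : IsGluing α q₁ q₂) (hf₂ : Function.Surjective (algebraMap B₂ B₀))
    (hinj : ∀ a : A, algebraMap A B₁ a = 0 → algebraMap A B₂ a = 0 → a = 0)
    (hex : ∀ b₁ b₂, algebraMap B₁ B₀ b₁ = algebraMap B₂ B₀ b₂ →
      ∃ a : A, algebraMap A B₁ a = b₁ ∧ algebraMap A B₂ a = b₂) :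
    ∃ (ι : Type) (_ : Fintype ι) (m : ι → M) (s : M →ₗ[A] ι → A)
      (s₁ : P₁ →ₗ[B₁] ι → B₁) (s₂ : P₂ →ₗ[B₂] ι → B₂),
      Submodule.span B₁ (Set.range (q₁ ∘ m)) = ⊤ ∧
      Submodule.span B₂ (Set.range (q₂ ∘ m)) = ⊤ ∧
      Fintype.linearCombination A m ∘ₗ s = LinearMap.id ∧
      (∀ k i, algebraMap A B₁ (s k i) = s₁ (q₁ k) i) ∧
      ∀ k i, algebraMap A B₂ (s k i) = s₂ (q₂ k) i := by
  obtain ⟨ι, _, m, h₁, h₂⟩ := h.exists_generators hf₂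
  obtain ⟨s₁, s₂, hs₁, hs₂, hs⟩ := h.exists_sections hf₂ m h₁ h₂
  choose s hsl hsr using fun k i => hex _ _ (hs k i)
  have hA (a b : A) (hl : algebraMap A B₁ a = algebraMap A B₁ b)
      (hr : algebraMap A B₂ a = algebraMap A B₂ b) : a = b :=
    sub_eq_zero.1 (hinj _ (by simp [hl]) (by simp [hr]))
  let s' : M →ₗ[A] ι → A :=
    { toFun := s
      map_add' := fun k k' => funext fun i => hA _ _ (by simp [hsl]) (by simp [hsr])
      map_smul' := fun a k => funext fun i => hA _ _
        (by rw [hsl, map_smul, ← algebraMap_smul B₁ a (q₁ k), map_smul]; simp [hsl])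
        (by rw [hsr, map_smul, ← algebraMap_smul B₂ a (q₂ k), map_smul]; simp [hsr]) }
  refine ⟨ι, inferInstance, m, s', s₁, s₂, h₁, h₂, LinearMap.ext fun k => ?_, hsl, hsr⟩
  refine h.ext ?_ ?_
  · have := hs₁ (q₁ k)
    simpa [s', Fintype.linearCombination_apply, ← hsl] using this
  · have := hs₂ (q₂ k)
    simpa [s', Fintype.linearCombination_apply, ← hsr] using this

end IsGluing

/-- If `M` is a retract of `A^ι` and the retraction extends to a family of generators
and a map `P → B^ι` along `q : M → P`, then `q` exhibits `P` as the base change of `M`. -/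
theorem liftBaseChange_bijective_of_retraction {B P : Type*} [CommRing B] [Algebra A B]
    [AddCommGroup P] [Module A P] [Module B P] [IsScalarTower A B P] (q : M →ₗ[A] P)
    {ι : Type*} [Fintype ι] (m : ι → M) (s : M →ₗ[A] ι → A) (s' : P →ₗ[B] ι → B)
    (hspan : Submodule.span B (Set.range (q ∘ m)) = ⊤)
    (hs : Fintype.linearCombination A m ∘ₗ s = LinearMap.id)
    (hq : ∀ k i, algebraMap A B (s k i) = s' (q k) i) :
    Function.Bijective (q.liftBaseChange B) := by
  constructor
  · let r : (ι → B) →ₗ[B] B ⊗[A] M := Fintype.linearCombination B fun i => 1 ⊗ₜ m i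
    have : r ∘ₗ s' ∘ₗ q.liftBaseChange B = LinearMap.id := by
      ext k
      have hk : ∑ i, s k i • m i = k := LinearMap.congr_fun hs k
      simp only [TensorProduct.AlgebraTensorModule.curry_apply, TensorProduct.curry_apply,
        LinearMap.comp_apply, LinearMap.liftBaseChange_tmul, one_smul,
        LinearMap.id_apply, LinearMap.restrictScalars_apply, r, Fintype.linearCombination_apply,
        ← hq, algebraMap_smul]
      conv_rhs => rw [← hk]
      simp [TensorProduct.tmul_sum]
    exact Function.LeftInverse.injective (g := r ∘ₗ s') (LinearMap.congr_fun this)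
  · rw [← LinearMap.range_eq_top, eq_top_iff, ← hspan, Submodule.span_le]
    rintro _ ⟨i, rfl⟩
    exact ⟨1 ⊗ₜ m i, by simp⟩

end Patching

/-- Milnor patching.  Let `f₁ : R₁ → R₀` and `f₂ : R₂ → R₀` be ring
homomorphisms (encoded as algebra structures) with `f₂` surjective, and let
`R = R₁ ×_{R₀} R₂` be the fiber product ring.  The base-change functor
`P ↦ (P ⊗_R R₁, P ⊗_R R₂, canonical glueing α_P)` from finite projective `R`-modules to
glueing triples `(P₁, P₂, α)` — `P₁` finite projective over `R₁`, `P₂` finite projective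
over `R₂`, `α : P₁ ⊗_{R₁} R₀ ≅ P₂ ⊗_{R₂} R₀` — is an equivalence of categories: it is
fully faithful (every pair of maps compatible with the glueing isomorphisms descends
uniquely to `R`) and essentially surjective (every triple is isomorphic, compatibly with
the glueing data, to the image of a finite projective `R`-module). -/
theorem stmt13 (hf₂ : Function.Surjective (algebraMap R₂ R₀)) :
    -- full faithfulness
    (∀ P Q : ModuleCat (fiberRing R₀ R₁ R₂),
      Module.Finite (fiberRing R₀ R₁ R₂) P → Module.Projective (fiberRing R₀ R₁ R₂) P →
      Module.Finite (fiberRing R₀ R₁ R₂) Q → Module.Projective (fiberRing R₀ R₁ R₂) Q →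
      ∀ (g₁ : R₁ ⊗[fiberRing R₀ R₁ R₂] P →ₗ[R₁] R₁ ⊗[fiberRing R₀ R₁ R₂] Q)
        (g₂ : R₂ ⊗[fiberRing R₀ R₁ R₂] P →ₗ[R₂] R₂ ⊗[fiberRing R₀ R₁ R₂] Q),
        (LinearMap.baseChange R₀ g₂) ∘ₗ (canGlue R₀ R₁ R₂ P).toLinearMap =
            (canGlue R₀ R₁ R₂ Q).toLinearMap ∘ₗ (LinearMap.baseChange R₀ g₁) →
        ∃! φ : P →ₗ[fiberRing R₀ R₁ R₂] Q,
          g₁ = LinearMap.baseChange R₁ φ ∧ g₂ = LinearMap.baseChange R₂ φ) ∧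
    -- essential surjectivity
    (∀ (P₁ : ModuleCat R₁) (P₂ : ModuleCat R₂),
      Module.Finite R₁ P₁ → Module.Projective R₁ P₁ →
      Module.Finite R₂ P₂ → Module.Projective R₂ P₂ →
      ∀ α : R₀ ⊗[R₁] P₁ ≃ₗ[R₀] R₀ ⊗[R₂] P₂,
      ∃ P : ModuleCat (fiberRing R₀ R₁ R₂),
        Module.Finite (fiberRing R₀ R₁ R₂) P ∧ Module.Projective (fiberRing R₀ R₁ R₂) P ∧
        ∃ (e₁ : R₁ ⊗[fiberRing R₀ R₁ R₂] P ≃ₗ[R₁] P₁)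
          (e₂ : R₂ ⊗[fiberRing R₀ R₁ R₂] P ≃ₗ[R₂] P₂),
          α.toLinearMap ∘ₗ (LinearMap.baseChange R₀ e₁.toLinearMap) ∘ₗ
              ((TensorProduct.AlgebraTensorModule.cancelBaseChange
                (fiberRing R₀ R₁ R₂) R₁ R₀ R₀ P).symm.toLinearMap) =
            (LinearMap.baseChange R₀ e₂.toLinearMap) ∘ₗ
              ((TensorProduct.AlgebraTensorModule.cancelBaseChange
                (fiberRing R₀ R₁ R₂) R₂ R₀ R₀ P).symm.toLinearMap)) := by
  have hinj (a : fiberRing R₀ R₁ R₂) (h₁ : algebraMap (fiberRing R₀ R₁ R₂) R₁ a = 0)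
      (h₂ : algebraMap (fiberRing R₀ R₁ R₂) R₂ a = 0) : a = 0 := Subtype.ext (Prod.ext h₁ h₂)
  have hex (b₁ : R₁) (b₂ : R₂) (hb : algebraMap R₁ R₀ b₁ = algebraMap R₂ R₀ b₂) :
      ∃ a : fiberRing R₀ R₁ R₂, algebraMap (fiberRing R₀ R₁ R₂) R₁ a = b₁ ∧
        algebraMap (fiberRing R₀ R₁ R₂) R₂ a = b₂ := ⟨⟨(b₁, b₂), hb⟩, rfl, rfl⟩
  refine ⟨?_, ?_⟩
  · intro P Q _ _ _ _ g₁ g₂ hg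
    have hc₁ (z : R₁ ⊗[fiberRing R₀ R₁ R₂] Q) :
        TensorProduct.AlgebraTensorModule.cancelBaseChange (fiberRing R₀ R₁ R₂) R₁ R₀ R₀ Q
          (1 ⊗ₜ z) =
        (IsScalarTower.toAlgHom (fiberRing R₀ R₁ R₂) R₁ R₀).toLinearMap.rTensor Q z := by
      induction z with
      | zero => simp
      | add z w hz hw => rw [TensorProduct.tmul_add, map_add, map_add, hz, hw]
      | tmul b q => simp [Algebra.smul_def]
    have hc₂ (z : R₂ ⊗[fiberRing R₀ R₁ R₂] Q) :
        TensorProduct.AlgebraTensorModule.cancelBaseChange (fiberRing R₀ R₁ R₂) R₂ R₀ R₀ Q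
          (1 ⊗ₜ z) =
        (IsScalarTower.toAlgHom (fiberRing R₀ R₁ R₂) R₂ R₀).toLinearMap.rTensor Q z := by
      induction z with
      | zero => simp
      | add z w hz hw => rw [TensorProduct.tmul_add, map_add, map_add, hz, hw]
      | tmul b q => simp [Algebra.smul_def]
    have : Module.Flat (fiberRing R₀ R₁ R₂) Q := Module.Flat.of_projective
    have key (p : P) := existsUnique_one_tmul_of_flat (B₀ := R₀) hinj hex
      (g₁ (1 ⊗ₜ p)) (g₂ (1 ⊗ₜ p)) <| by
        have := LinearMap.congr_fun hg (1 ⊗ₜ (1 ⊗ₜ p))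
        simp only [canGlue, LinearMap.comp_apply, LinearEquiv.coe_coe, LinearEquiv.trans_apply,
          TensorProduct.AlgebraTensorModule.cancelBaseChange_tmul, one_smul,
          TensorProduct.AlgebraTensorModule.cancelBaseChange_symm_tmul,
          LinearMap.baseChange_tmul] at this
        rw [← hc₁, ← hc₂, this, LinearEquiv.apply_symm_apply]
    choose φ hφ hφu using key
    have hφ₁ (p : P) := (hφ p).1
    have hφ₂ (p : P) := (hφ p).2
    let φ' : P →ₗ[fiberRing R₀ R₁ R₂] Q :=
      { toFun := φ
        map_add' := fun p p' => (hφu _ _ (by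
          simp only [TensorProduct.tmul_add, map_add, hφ₁, hφ₂, and_self])).symm
        map_smul' := fun a p => (hφu _ _ (by
          simp only [RingHom.id_apply, TensorProduct.tmul_smul, hφ₁, hφ₂,
            LinearMap.map_smul_of_tower, and_self])).symm }
    refine ⟨φ', ⟨?_, ?_⟩, ?_⟩
    · ext p
      simp [φ', hφ₁]
    · ext p
      simp [φ', hφ₂]
    · rintro ψ ⟨rfl, rfl⟩
      ext p
      exact hφu p (ψ p) (by simp)
  · intro P₁ P₂ _ _ _ _ α
    let : Module (fiberRing R₀ R₁ R₂) P₁ :=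
      Module.compHom P₁ (algebraMap (fiberRing R₀ R₁ R₂) R₁)
    let : Module (fiberRing R₀ R₁ R₂) P₂ :=
      Module.compHom P₂ (algebraMap (fiberRing R₀ R₁ R₂) R₂)
    have : IsScalarTower (fiberRing R₀ R₁ R₂) R₁ P₁ :=
      IsScalarTower.of_algebraMap_smul fun _ _ => rfl
    have : IsScalarTower (fiberRing R₀ R₁ R₂) R₂ P₂ :=
      IsScalarTower.of_algebraMap_smul fun _ _ => rfl
    obtain ⟨ι, _, m, s, -, -, -, -, hs, -, -⟩ :=
      (isGluing_gluing (A := fiberRing R₀ R₁ R₂) α).exists_retraction hf₂ hinj hex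
    let e := ULift.moduleEquiv.trans (LinearEquiv.symm <| LinearEquiv.ofInjective s
      (Function.LeftInverse.injective (g := Fintype.linearCombination _ m)
        (LinearMap.congr_fun hs)))
    have h := (isGluing_gluing (A := fiberRing R₀ R₁ R₂) α).comp_equiv e
    obtain ⟨ι, _, m, s, s₁, s₂, h₁, h₂, hs, hs₁, hs₂⟩ := h.exists_retraction hf₂ hinj hex
    refine ⟨ModuleCat.of (fiberRing R₀ R₁ R₂) _,
      Module.Finite.of_surjective (Fintype.linearCombination _ m)
        (Function.RightInverse.surjective (g := s) (LinearMap.congr_fun hs)),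
      Module.Projective.of_split s _ hs,
      LinearEquiv.ofBijective _ (liftBaseChange_bijective_of_retraction _ m s s₁ h₁ hs hs₁),
      LinearEquiv.ofBijective _ (liftBaseChange_bijective_of_retraction _ m s s₂ h₂ hs hs₂), ?_⟩
    ext k
    simpa using h.compat k

end
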